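/- arXiv:1910.00805 — 4 statements merged into one kernel-verified Lean document; each statement's English description precedes it below -/
import Mathlib

section
/- Let N be a positive integer, let S be an N×N complex diagonal matrix whose diagonal entries all lie in {0,1}, and let P be an N×N complex matrix with P² = P and Pᴴ = P. Then for every real μ with 0 ≤ μ ≤ 2, the matrix A_μ = (I − μS)P is nonexpansive: ‖A_μ v‖ ≤ ‖v‖ for all v ∈ ℂ^N. -/
open scoped Matrix.Norms.L2Operator in
/-- A relaxed reflection `I - μ S` along a diagonal `0`-`1` matrix has operator norm at most `1`
when `0 ≤ μ ≤ 2`. -/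
theorem norm_one_sub_smul_le_one {n : Type*} [Fintype n] [DecidableEq n] {S : Matrix n n ℂ}
    (hdiag : S.IsDiag) (h01 : ∀ i, S i i = 0 ∨ S i i = 1)
    {μ : ℝ} (hμ0 : 0 ≤ μ) (hμ2 : μ ≤ 2) :
    ‖(1 : Matrix n n ℂ) - (μ : ℂ) • S‖ ≤ 1 := by
  have hD : (1 : Matrix n n ℂ) - (μ : ℂ) • S
      = Matrix.diagonal fun i => 1 - (μ : ℂ) * S i i := by
    nth_rewrite 1 [← hdiag.diagonal_diag]
    ext i j
    by_cases h : i = j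
    · subst h
      simp
    · simp [h]
  rw [hD, Matrix.l2_opNorm_diagonal, pi_norm_le_iff_of_nonneg zero_le_one]
  intro i
  rcases h01 i with h | h
  · simp [h]
  · rw [h, mul_one, ← Complex.ofReal_one, ← Complex.ofReal_sub, Complex.norm_real,
      Real.norm_eq_abs, abs_le]
    constructor <;> linarith

open scoped Matrix.Norms.L2Operator in
/-- The product of a contraction with an orthogonal projection is nonexpansive. -/
theorem norm_toEuclideanLin_mul_le {n : Type*} [Fintype n] [DecidableEq n] {A P : Matrix n n ℂ}
    (hA : ‖A‖ ≤ 1) (hP : IsStarProjection P) (v : EuclideanSpace ℂ n) :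
    ‖Matrix.toEuclideanLin (A * P) v‖ ≤ ‖v‖ :=
  calc _ ≤ ‖A * P‖ * ‖v‖ := Matrix.l2_opNorm_mulVec _ v
    _ ≤ 1 * ‖v‖ := by
        gcongr
        exact (norm_mul_le _ _).trans
          (mul_le_one₀ hA (norm_nonneg _) (IsStarProjection.norm_le P hP))
    _ = ‖v‖ := one_mul _


/-- For a sampling matrix `S` (diagonal with entries in `{0,1}`) and an orthogonal
projection `P` (`P² = P`, `Pᴴ = P`), the matrix `A_μ = (I - μ S) P` is nonexpansive with respect
to the Euclidean norm for every real `μ` with `0 ≤ μ ≤ 2`. -/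
theorem Amu_nonexpansive
    (N : ℕ) (hN : 0 < N) (S P : Matrix (Fin N) (Fin N) ℂ)
    (hdiag : S.IsDiag) (h01 : ∀ i, S i i = 0 ∨ S i i = 1)
    (hP2 : P * P = P) (hPH : P.conjTranspose = P)
    (μ : ℝ) (hμ0 : 0 ≤ μ) (hμ2 : μ ≤ 2) :
    ∀ v : EuclideanSpace ℂ (Fin N),
      ‖Matrix.toEuclideanLin (((1 : Matrix (Fin N) (Fin N) ℂ) - (μ : ℂ) • S) * P) v‖ ≤ ‖v‖ := by
  exact norm_toEuclideanLin_mul_le (norm_one_sub_smul_le_one hdiag h01 hμ0 hμ2) ⟨hP2, hPH⟩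
end

section
/- Let S be an N×N complex diagonal matrix with diagonal entries in {0,1}, and let P be an N×N complex matrix with P² = P and Pᴴ = P. Assume 0 < μ < 2 and assume that the only vector v ∈ ℂ^N satisfying both Pv = v and Sv = 0 is v = 0. Then the matrix A_μ = (I − μS)P is strictly nonexpansive: ‖A_μ v‖ < ‖v‖ for every nonzero v ∈ ℂ^N. -/
/-- An orthogonal projection strictly decreases the norm of every vector it moves. -/
lemma Matrix.norm_toEuclideanLin_lt_of_isProj {n : Type*} [Fintype n] [DecidableEq n]
    {P : Matrix n n ℂ} (hP2 : P * P = P) (hPH : P.conjTranspose = P)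
    {v : EuclideanSpace ℂ n} (hv : Matrix.toEuclideanLin P v ≠ v) :
    ‖Matrix.toEuclideanLin P v‖ < ‖v‖ := by
  have hsymm : (Matrix.toEuclideanLin P).IsSymmetric :=
    Matrix.isSymmetric_toEuclideanLin_iff.mpr hPH
  have hidem : Matrix.toEuclideanLin P (Matrix.toEuclideanLin P v) = Matrix.toEuclideanLin P v := by
    ext i
    simp [Matrix.toLpLin_apply, Matrix.mulVec_mulVec, hP2]
  have horth : inner ℂ (Matrix.toEuclideanLin P v) (v - Matrix.toEuclideanLin P v) = 0 := by
    rw [hsymm, map_sub, hidem, sub_self, inner_zero_right]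
  have hpyth := norm_add_sq_eq_norm_sq_add_norm_sq_of_inner_eq_zero _ _ horth
  rw [add_sub_cancel] at hpyth
  have hpos : 0 < ‖v - Matrix.toEuclideanLin P v‖ := norm_pos_iff.mpr (sub_ne_zero.mpr hv.symm)
  nlinarith [norm_nonneg v, norm_nonneg (Matrix.toEuclideanLin P v)]

lemma Matrix.toEuclideanLin_one_sub_smul_diagonal_apply {n : Type*} [Fintype n] [DecidableEq n]
    (c : ℂ) (d : n → ℂ) (w : EuclideanSpace ℂ n) (i : n) :
    Matrix.toEuclideanLin (1 - c • Matrix.diagonal d) w i = (1 - c * d i) * w i := by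
  simp [Matrix.toLpLin_apply, Matrix.mulVec_diagonal,
    sub_mul, mul_assoc]

lemma Complex.norm_one_sub_ofReal_lt_one {μ : ℝ} (hμ0 : 0 < μ) (hμ2 : μ < 2) :
    ‖(1 : ℂ) - μ‖ < 1 := by
  rw [← Complex.ofReal_one, ← Complex.ofReal_sub, Complex.norm_real, Real.norm_eq_abs, abs_lt]
  constructor <;> linarith

lemma Complex.norm_one_sub_ofReal_mul_mul_le {μ : ℝ} (hμ0 : 0 < μ) (hμ2 : μ < 2) {d : ℂ}
    (hd : d = 0 ∨ d = 1) (z : ℂ) : ‖(1 - μ * d) * z‖ ≤ ‖z‖ := by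
  rcases hd with rfl | rfl
  · simp
  · rw [mul_one, norm_mul]
    exact mul_le_of_le_one_left (norm_nonneg z) (norm_one_sub_ofReal_lt_one hμ0 hμ2).le

/-- A relaxed sampling operator is nonexpansive. -/
lemma Matrix.norm_toEuclideanLin_one_sub_smul_diagonal_le {n : Type*} [Fintype n] [DecidableEq n]
    {μ : ℝ} (hμ0 : 0 < μ) (hμ2 : μ < 2) {d : n → ℂ} (hd : ∀ i, d i = 0 ∨ d i = 1)
    (w : EuclideanSpace ℂ n) :
    ‖Matrix.toEuclideanLin (1 - (μ : ℂ) • Matrix.diagonal d) w‖ ≤ ‖w‖ := by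
  rw [EuclideanSpace.norm_eq, EuclideanSpace.norm_eq]
  refine Real.sqrt_le_sqrt (Finset.sum_le_sum fun i _ => ?_)
  rw [toEuclideanLin_one_sub_smul_diagonal_apply]
  gcongr
  exact Complex.norm_one_sub_ofReal_mul_mul_le hμ0 hμ2 (hd i) _

/-- A relaxed sampling operator strictly decreases the norm of every vector that does not vanish
on the sampling set. -/
lemma Matrix.norm_toEuclideanLin_one_sub_smul_diagonal_lt {n : Type*} [Fintype n] [DecidableEq n]
    {μ : ℝ} (hμ0 : 0 < μ) (hμ2 : μ < 2) {d : n → ℂ} (hd : ∀ i, d i = 0 ∨ d i = 1)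
    {w : EuclideanSpace ℂ n} (hw : (Matrix.diagonal d).mulVec w.ofLp ≠ 0) :
    ‖Matrix.toEuclideanLin (1 - (μ : ℂ) • Matrix.diagonal d) w‖ < ‖w‖ := by
  obtain ⟨j, hj⟩ := Function.ne_iff.mp hw
  rw [Matrix.mulVec_diagonal, Pi.zero_apply, mul_ne_zero_iff] at hj
  have hdj : d j = 1 := (hd j).resolve_left hj.1
  rw [EuclideanSpace.norm_eq, EuclideanSpace.norm_eq]
  refine Real.sqrt_lt_sqrt (by positivity) (Finset.sum_lt_sum (fun i _ => ?_)
    ⟨j, Finset.mem_univ j, ?_⟩) <;> rw [toEuclideanLin_one_sub_smul_diagonal_apply]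
  · gcongr
    exact Complex.norm_one_sub_ofReal_mul_mul_le hμ0 hμ2 (hd i) _
  · gcongr
    rw [hdj, mul_one, norm_mul]
    exact mul_lt_of_lt_one_left (norm_pos_iff.mpr hj.2)
      (Complex.norm_one_sub_ofReal_lt_one hμ0 hμ2)


/-- Let `S` be a sampling matrix (diagonal, entries in `{0,1}`), `P` an orthogonal
projection (`P² = P`, `Pᴴ = P`), `0 < μ < 2`, and assume the only `v` with `Pv = v` and `Sv = 0`
is `v = 0`. Then `A_μ = (I - μ S) P` is strictly nonexpansive: `‖A_μ v‖ < ‖v‖` for `v ≠ 0`. -/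
theorem Amu_strictly_nonexpansive
    (N : ℕ) (S P : Matrix (Fin N) (Fin N) ℂ)
    (hdiag : S.IsDiag) (h01 : ∀ i, S i i = 0 ∨ S i i = 1)
    (hP2 : P * P = P) (hPH : P.conjTranspose = P)
    (μ : ℝ) (hμ0 : 0 < μ) (hμ2 : μ < 2)
    (huniq : ∀ v : Fin N → ℂ, P.mulVec v = v → S.mulVec v = 0 → v = 0) :
    ∀ v : EuclideanSpace ℂ (Fin N), v ≠ 0 →
      ‖Matrix.toEuclideanLin (((1 : Matrix (Fin N) (Fin N) ℂ) - (μ : ℂ) • S) * P) v‖ < ‖v‖ := by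
  intro v hv
  obtain ⟨d, rfl⟩ : ∃ d, S = Matrix.diagonal d := ⟨_, hdiag.diagonal_diag.symm⟩
  have hd : ∀ i, d i = 0 ∨ d i = 1 := fun i => by simpa using h01 i
  have hcomp : Matrix.toEuclideanLin ((1 - (μ : ℂ) • Matrix.diagonal d) * P) v =
      Matrix.toEuclideanLin (1 - (μ : ℂ) • Matrix.diagonal d) (Matrix.toEuclideanLin P v) := by
    simp [Matrix.toLpLin_apply, Matrix.mulVec_mulVec]
  rw [hcomp]
  by_cases hPv : Matrix.toEuclideanLin P v = v
  · rw [hPv]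
    refine Matrix.norm_toEuclideanLin_one_sub_smul_diagonal_lt hμ0 hμ2 hd fun hSv => hv ?_
    exact WithLp.ofLp_injective 2 (huniq v.ofLp (congrArg WithLp.ofLp hPv) hSv)
  · exact (Matrix.norm_toEuclideanLin_one_sub_smul_diagonal_le hμ0 hμ2 hd _).trans_lt
      (Matrix.norm_toEuclideanLin_lt_of_isProj hP2 hPH hPv)
end

section
/- Let S be an N×N complex diagonal matrix with diagonal entries in {0,1}, let P be an N×N complex matrix with P² = P and Pᴴ = P, let 0 < μ < 2, and assume that the only vector v with Pv = v and Sv = 0 is v = 0. Let f ∈ ℂ^N satisfy Pf = f. Then f is the unique fixed point of the map T′(x) = μSf + (I − μS)Px, and for any initial vector f⁽¹⁾ ∈ ℂ^N the Papoulis-Gerchberg iteration f⁽ᵏ⁺¹⁾ = μSf + (I − μS)P f⁽ᵏ⁾ converges to f as k → ∞. -/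
open Filter Topology

/-- A strictly norm-decreasing operator on a finite-dimensional space has norm less than one. -/
theorem ContinuousLinearMap.opNorm_lt_one_of_forall_norm_lt {E : Type*} [NormedAddCommGroup E]
    [NormedSpace ℂ E] [FiniteDimensional ℂ E] (T : E →L[ℂ] E)
    (hT : ∀ x, x ≠ 0 → ‖T x‖ < ‖x‖) : ‖T‖ < 1 := by
  have : ProperSpace E := FiniteDimensional.proper ℂ E
  rcases (Metric.sphere (0 : E) 1).eq_empty_or_nonempty with hempty | hne
  · have hzero : T = 0 := by
      ext x
      by_contra hx
      have hx0 : x ≠ 0 := fun h => hx (by simp [h])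
      have hmem : ((‖x‖⁻¹ : ℝ) : ℂ) • x ∈ Metric.sphere (0 : E) 1 := by
        simp [norm_smul, hx0]
      simp [hempty] at hmem
    simp [hzero]
  · obtain ⟨x₀, hx₀, hmax⟩ := (isCompact_sphere (0 : E) 1).exists_isMaxOn hne
      (f := fun x => ‖T x‖) (by fun_prop)
    have hx₀' : ‖x₀‖ = 1 := by simpa using hx₀
    refine lt_of_le_of_lt (T.opNorm_le_bound (norm_nonneg (T x₀)) fun x => ?_)
      (hx₀' ▸ hT x₀ (by rintro rfl; simp at hx₀'))
    rcases eq_or_ne x 0 with rfl | hx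
    · simp
    · have hmem : ((‖x‖⁻¹ : ℝ) : ℂ) • x ∈ Metric.sphere (0 : E) 1 := by
        simp [norm_smul, hx]
      have hle : ‖T (((‖x‖⁻¹ : ℝ) : ℂ) • x)‖ ≤ ‖T x₀‖ := hmax hmem
      rw [map_smul, norm_smul, Complex.norm_real, norm_inv, norm_norm,
        inv_mul_le_iff₀ (norm_pos_iff.mpr hx), mul_comm] at hle
      exact hle

/-- An orthogonal projection matrix does not increase the Euclidean norm. -/
theorem Matrix.norm_toLp_mulVec_le_of_isStarProjection {n : Type*} [Fintype n] [DecidableEq n]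
    {P : Matrix n n ℂ} (hP : IsStarProjection P) (x : n → ℂ) :
    ‖WithLp.toLp 2 (P.mulVec x)‖ ≤ ‖WithLp.toLp 2 x‖ := by
  have hle := (Matrix.toEuclideanCLM (n := n) (𝕜 := ℂ) P).le_of_opNorm_le
    (hP.map (Matrix.toEuclideanCLM (n := n) (𝕜 := ℂ))).norm_le (WithLp.toLp 2 x)
  simpa using hle

/-- Relaxing on the sampling set with `0 < μ < 2` strictly decreases the norm of every vector
that does not vanish there. -/
theorem Matrix.norm_toLp_one_sub_smul_mulVec_lt {n : Type*} [Fintype n] [DecidableEq n]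
    {S : Matrix n n ℂ} (hdiag : S.IsDiag) (h01 : ∀ i, S i i = 0 ∨ S i i = 1)
    {μ : ℝ} (hμ0 : 0 < μ) (hμ2 : μ < 2) {y : n → ℂ} (hy : S.mulVec y ≠ 0) :
    ‖WithLp.toLp 2 ((1 - (μ : ℂ) • S).mulVec y)‖ < ‖WithLp.toLp 2 y‖ := by
  have hS (i : n) : S.mulVec y i = S i i * y i := by
    conv_lhs => rw [← hdiag.diagonal_diag, Matrix.mulVec_diagonal]
    rfl
  have happ (i : n) : (1 - (μ : ℂ) • S).mulVec y i = (1 - μ * S i i) * y i := by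
    simp only [Matrix.sub_mulVec, Matrix.one_mulVec, Matrix.smul_mulVec, Pi.sub_apply,
      Pi.smul_apply, smul_eq_mul, hS]
    ring
  have habs : ‖(1 - μ : ℂ)‖ < 1 := by
    rw [← Complex.ofReal_one, ← Complex.ofReal_sub, Complex.norm_real, Real.norm_eq_abs, abs_lt]
    constructor <;> linarith
  obtain ⟨j, hj⟩ := Function.ne_iff.mp hy
  rw [hS, Pi.zero_apply, mul_ne_zero_iff] at hj
  rw [EuclideanSpace.norm_eq, EuclideanSpace.norm_eq]
  refine Real.sqrt_lt_sqrt (by positivity) (Finset.sum_lt_sum (fun i _ => ?_)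
    ⟨j, Finset.mem_univ j, ?_⟩)
  · simp only [happ, norm_mul]
    gcongr
    refine mul_le_of_le_one_left (norm_nonneg _) ?_
    rcases h01 i with h | h <;> simp [h, habs.le]
  · simp only [happ, norm_mul, (h01 j).resolve_left hj.1, mul_one]
    gcongr
    exact mul_lt_of_lt_one_left (norm_pos_iff.mpr hj.2) habs

/-- Under the hypotheses of Theorem 2 (sampling matrix `S`, orthogonal projection
`P`, `0 < μ < 2`, no nonzero bandlimited signal vanishing on the sampling set), a bandlimited
signal `f` (`Pf = f`) is the unique fixed point of `T′(x) = μSf + (I - μS)Px`, and the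
Papoulis-Gerchberg iteration `f⁽ᵏ⁺¹⁾ = μSf + (I - μS)P f⁽ᵏ⁾` converges to `f` from any
initial vector. -/
theorem papoulis_gerchberg_converges
    (N : ℕ) (S P : Matrix (Fin N) (Fin N) ℂ)
    (hdiag : S.IsDiag) (h01 : ∀ i, S i i = 0 ∨ S i i = 1)
    (hP2 : P * P = P) (hPH : P.conjTranspose = P)
    (μ : ℝ) (hμ0 : 0 < μ) (hμ2 : μ < 2)
    (huniq : ∀ v : Fin N → ℂ, P.mulVec v = v → S.mulVec v = 0 → v = 0)
    (f : Fin N → ℂ) (hf : P.mulVec f = f) :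
    (f = (μ : ℂ) • S.mulVec f +
        (((1 : Matrix (Fin N) (Fin N) ℂ) - (μ : ℂ) • S) * P).mulVec f) ∧
    (∀ g : Fin N → ℂ,
        g = (μ : ℂ) • S.mulVec f +
            (((1 : Matrix (Fin N) (Fin N) ℂ) - (μ : ℂ) • S) * P).mulVec g → g = f) ∧
    ∀ f1 : Fin N → ℂ,
      Filter.Tendsto
        (fun k : ℕ => (fun x : Fin N → ℂ =>
          (μ : ℂ) • S.mulVec f +
            (((1 : Matrix (Fin N) (Fin N) ℂ) - (μ : ℂ) • S) * P).mulVec x)^[k] f1)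
        Filter.atTop (nhds f) := by
  set M := ((1 : Matrix (Fin N) (Fin N) ℂ) - (μ : ℂ) • S) * P with hM
  have hfix : f = (μ : ℂ) • S.mulVec f + M.mulVec f := by
    rw [hM, ← Matrix.mulVec_mulVec, hf, Matrix.sub_mulVec, Matrix.one_mulVec, Matrix.smul_mulVec]
    abel
  have hstar : IsStarProjection P := ⟨hP2, hPH⟩
  have hlt (x : EuclideanSpace ℂ (Fin N)) (hx : x ≠ 0) :
      ‖Matrix.toEuclideanCLM (n := Fin N) (𝕜 := ℂ) M x‖ < ‖x‖ := by
    change ‖WithLp.toLp 2 (M.mulVec x.ofLp)‖ < ‖x‖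
    rw [hM, ← Matrix.mulVec_mulVec]
    by_cases hPx : P.mulVec x.ofLp = 0
    · simpa [hPx] using hx
    · refine (Matrix.norm_toLp_one_sub_smul_mulVec_lt hdiag h01 hμ0 hμ2 fun h => hPx ?_).trans_le
        (Matrix.norm_toLp_mulVec_le_of_isStarProjection hstar x.ofLp)
      exact huniq _ (by rw [Matrix.mulVec_mulVec, hP2]) h
  have hconv (f1 : Fin N → ℂ) : Tendsto
      (fun k : ℕ => (fun x => (μ : ℂ) • S.mulVec f + M.mulVec x)^[k] f1) atTop (𝓝 f) := by
    have hpow := tendsto_pow_atTop_nhds_zero_of_norm_lt_one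
      (ContinuousLinearMap.opNorm_lt_one_of_forall_norm_lt _ hlt)
    have herr : Tendsto (fun k : ℕ => (M ^ k).mulVec (f1 - f)) atTop (𝓝 0) := by
      have happ := ((PiLp.continuous_ofLp 2 fun _ : Fin N => ℂ).tendsto _).comp
        (((ContinuousLinearMap.apply ℂ (EuclideanSpace ℂ (Fin N))
          (WithLp.toLp 2 (f1 - f))).continuous.tendsto _).comp hpow)
      simpa [Function.comp_def, ← map_pow, Matrix.mulVec_sub] using happ
    have hiter (k : ℕ) : (fun x => (μ : ℂ) • S.mulVec f + M.mulVec x)^[k] f1 =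
        f + (M ^ k).mulVec (f1 - f) := by
      induction k with
      | zero => simp
      | succ k ih =>
        rw [Function.iterate_succ_apply', ih, Matrix.mulVec_add, ← add_assoc, ← hfix,
          Matrix.mulVec_mulVec, ← pow_succ']
    simpa only [hiter, add_zero] using herr.const_add f
  refine ⟨hfix, fun g hg => ?_, hconv⟩
  have hiter (k : ℕ) : (fun x => (μ : ℂ) • S.mulVec f + M.mulVec x)^[k] g = g :=
    Function.iterate_fixed hg.symm k
  exact tendsto_nhds_unique (by simp only [hiter, tendsto_const_nhds]) (hconv g)
end

section
/- Let r be a real number with 0 ≤ r < 1 and define g(μ) = max(μ − 1, 1 − μ(1 − r)) for μ ∈ [1, 2]. Then g attains its minimum on [1, 2] uniquely at μ_opt = 2/(2 − r), the minimum value is g(μ_opt) = r/(2 − r), and this value satisfies r/(2 − r) ≤ r with strict inequality whenever r > 0. -/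
/-- For `0 ≤ r < 1` and `g(μ) = max (μ - 1) (1 - μ(1 - r))` on `[1, 2]`:
`μ_opt = 2/(2 - r)` lies in `[1, 2]`, `g` attains its minimum on `[1, 2]` uniquely at `μ_opt`,
the minimum value is `r/(2 - r)`, and `r/(2 - r) ≤ r`, strictly when `r > 0`. -/
theorem optimal_relaxation_parameter
    (r : ℝ) (hr0 : 0 ≤ r) (hr1 : r < 1) :
    (2 / (2 - r) ∈ Set.Icc (1 : ℝ) 2) ∧
    (max (2 / (2 - r) - 1) (1 - 2 / (2 - r) * (1 - r)) = r / (2 - r)) ∧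
    (∀ μ ∈ Set.Icc (1 : ℝ) 2, r / (2 - r) ≤ max (μ - 1) (1 - μ * (1 - r))) ∧
    (∀ μ ∈ Set.Icc (1 : ℝ) 2,
        max (μ - 1) (1 - μ * (1 - r)) = r / (2 - r) → μ = 2 / (2 - r)) ∧
    (r / (2 - r) ≤ r) ∧ (0 < r → r / (2 - r) < r) := by
  have h2 : 0 < 2 - r := by linarith
  have h1 : 0 < 1 - r := by linarith
  have hleft : r / (2 - r) = 2 / (2 - r) - 1 := by field_simp; ring
  have hright : r / (2 - r) = 1 - 2 / (2 - r) * (1 - r) := by field_simp; ring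
  refine ⟨⟨?_, ?_⟩, ?_, fun μ _ => ?_, fun μ _ h => ?_, ?_, fun hr => ?_⟩
  · rw [le_div_iff₀ h2]; linarith
  · rw [div_le_iff₀ h2]; linarith
  · rw [← hleft, ← hright, max_self]
  · rcases le_total (2 / (2 - r)) μ with hμ | hμ
    · exact le_max_of_le_left (by linarith)
    · exact le_max_of_le_right (by linarith [mul_le_mul_of_nonneg_right hμ h1.le])
  · obtain ⟨hl, hr⟩ := max_le_iff.mp h.le
    exact le_antisymm (by linarith) (le_of_mul_le_mul_right (by linarith) h1)
  · exact div_le_self hr0 (by linarith)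
  · exact div_lt_self hr (by linarith)
end
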